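/- F is an essential left ideal and an essential right ideal of R: every nonzero left ideal of R has nonzero intersection with F, and every nonzero right ideal of R has nonzero intersection with F. -/

import Mathlib

/-!
`R = k⟨x,y⟩/⟨yx − 1⟩` is the associative `k`-algebra generated by `x` and `y`
with the single defining relation `y * x = 1` (the one-sided inverse of `k[x]`).
We realize it as the `RingQuot` of the free algebra on two generators.
-/

noncomputable section

/-- The defining relation `y * x = 1` on the free algebra `k⟨x,y⟩`. -/
inductive PreRel (k : Type) [Field k] : FreeAlgebra k (Fin 2) → FreeAlgebra k (Fin 2) → Prop
  | yx : PreRel k (FreeAlgebra.ι k 1 * FreeAlgebra.ι k 0) 1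

/-- `R = k⟨x,y⟩/⟨yx − 1⟩`. -/
abbrev R (k : Type) [Field k] := RingQuot (PreRel k)

/-- The generator `x` of `R`. -/
def Xg (k : Type) [Field k] : R k := RingQuot.mkAlgHom k (PreRel k) (FreeAlgebra.ι k 0)

/-- The generator `y` of `R`. -/
def Yg (k : Type) [Field k] : R k := RingQuot.mkAlgHom k (PreRel k) (FreeAlgebra.ι k 1)

/-- `F = ⟨1 − xy⟩`, the two-sided ideal of `R` generated by `1 − xy`. -/
def Fideal (k : Type) [Field k] : TwoSidedIdeal (R k) :=
  TwoSidedIdeal.span {1 - Xg k * Yg k}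

section general

variable {k A : Type} [Field k] [Ring A] [Algebra k A] {x y : A}

lemma aux_pow (h : y * x = 1) (n : ℕ) : y ^ n * x ^ n = 1 := by
  induction n with
  | zero => simp
  | succ n ih => rw [pow_succ, pow_succ', mul_assoc, ← mul_assoc y, h, one_mul, ih]

lemma aux_reg (h : y * x = 1) {a : A} (ha : a ∈ Algebra.adjoin k ({x, y} : Set A)) :
    ∃ (N : ℕ) (p : Polynomial k), y ^ N * a = Polynomial.aeval y p := by
  induction ha using Algebra.adjoin_induction with
  | mem z hz =>
    rcases hz with rfl | hz
    · exact ⟨1, 1, by simpa using h⟩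
    · rw [Set.mem_singleton_iff] at hz
      exact ⟨0, Polynomial.X, by simp [hz]⟩
  | algebraMap r => exact ⟨0, Polynomial.C r, by simp⟩
  | add a b _ _ ha hb =>
    obtain ⟨N, p, hp⟩ := ha
    obtain ⟨M, q, hq⟩ := hb
    refine ⟨N + M, Polynomial.X ^ M * p + Polynomial.X ^ N * q, ?_⟩
    rw [mul_add, map_add, map_mul, map_mul, ← hp, ← hq]
    simp only [map_pow, Polynomial.aeval_X, ← mul_assoc, ← pow_add, add_comm M N]
  | mul a b _ _ ha hb =>
    obtain ⟨N, p, hp⟩ := ha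
    obtain ⟨M, q, hq⟩ := hb
    refine ⟨M + N, p * q, ?_⟩
    have hc : y ^ M * Polynomial.aeval y p = Polynomial.aeval y p * y ^ M := by
      have := congrArg (Polynomial.aeval y) (mul_comm (Polynomial.X ^ M) p)
      simpa using this
    rw [pow_add, mul_assoc, ← mul_assoc (y ^ N), hp, ← mul_assoc, hc, mul_assoc, hq, map_mul]

lemma aux_poly (h : y * x = 1) (he : 1 - x * y ≠ 0) (p : Polynomial k)
    (hp : (1 - x * y) * Polynomial.aeval y p = 0) : p = 0 := by
  have hye : y * (1 - x * y) = 0 := by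
    rw [mul_sub, ← mul_assoc, h]; simp
  have hex : (1 - x * y) * x = 0 := by
    rw [sub_mul, mul_assoc, h]; simp
  have hee : (1 - x * y) * (1 - x * y) = 1 - x * y := by
    rw [mul_sub, ← mul_assoc, hex]; simp
  have key : ∀ j m : ℕ, (1 - x * y) * (y ^ j * (x ^ m * (1 - x * y))) =
      if j = m then 1 - x * y else 0 := by
    intro j m
    rcases lt_trichotomy j m with hl | rfl | hl
    · obtain ⟨d, rfl⟩ := Nat.exists_eq_add_of_lt hl
      rw [if_neg hl.ne, add_assoc, pow_add x, mul_assoc (x ^ j), ← mul_assoc (y ^ j), aux_pow h,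
        one_mul, pow_succ', mul_assoc, ← mul_assoc, hex, zero_mul]
    · rw [if_pos rfl, ← mul_assoc (y ^ j), aux_pow h, one_mul, hee]
    · obtain ⟨d, rfl⟩ := Nat.exists_eq_add_of_lt hl
      rw [if_neg hl.ne', add_assoc, add_comm m, pow_add y, mul_assoc, ← mul_assoc (y ^ m),
        aux_pow h, one_mul, pow_succ, mul_assoc, hye, mul_zero, mul_zero]
  ext m
  have h2 : (1 - x * y) * (Polynomial.aeval y p * (x ^ m * (1 - x * y))) = 0 := by
    rw [← mul_assoc, hp, zero_mul]
  rw [Polynomial.aeval_eq_sum_range' (Nat.lt_succ_of_le (le_max_left p.natDegree m)),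
    Finset.sum_mul, Finset.mul_sum] at h2
  simp only [smul_mul_assoc, mul_smul_comm, key] at h2
  simp only [smul_ite, smul_zero] at h2
  rw [Finset.sum_ite_eq' , if_pos (by simp)] at h2
  simpa [he] using h2

lemma aux_main (h : y * x = 1) (he : 1 - x * y ≠ 0) {a : A}
    (ha : a ∈ Algebra.adjoin k ({x, y} : Set A)) (h0 : a ≠ 0) :
    ∃ n : ℕ, (1 - x * y) * (y ^ n * a) ≠ 0 := by
  by_contra! hn
  have hx : ∀ n : ℕ, a = x ^ n * (y ^ n * a) := by
    intro n
    induction n with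
    | zero => simp
    | succ n ih =>
      have := hn n
      rw [sub_mul, one_mul, sub_eq_zero] at this
      rw [this] at ih
      rw [pow_succ, pow_succ', mul_assoc, mul_assoc]
      simpa [mul_assoc] using ih
  obtain ⟨N, p, hp⟩ := aux_reg h ha
  have hpz := aux_poly h he p (hp ▸ hn N)
  apply h0
  rw [hx N, hp, hpz]
  simp

end general

lemma R_yx (k : Type) [Field k] : Yg k * Xg k = 1 := by
  have := RingQuot.mkAlgHom_rel k (PreRel.yx (k := k))
  simpa [Xg, Yg] using this

lemma R_adjoin (k : Type) [Field k] : Algebra.adjoin k ({Xg k, Yg k} : Set (R k)) = ⊤ := by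
  have h1 := congrArg (Subalgebra.map (RingQuot.mkAlgHom k (PreRel k)))
    (FreeAlgebra.adjoin_range_ι k (Fin 2))
  rw [AlgHom.map_adjoin, Algebra.map_top,
    (AlgHom.range_eq_top _).2 (RingQuot.mkAlgHom_surjective k (PreRel k))] at h1
  rw [← h1]
  congr 1
  ext z
  simp [Xg, Yg, eq_comm]

/-- Right shift on sequences. -/
def shR (k : Type) [Field k] : Module.End k (ℕ → k) where
  toFun f n := if n = 0 then 0 else f (n - 1)
  map_add' f g := by ext n; by_cases h : n = 0 <;> simp [h]
  map_smul' c f := by ext n; by_cases h : n = 0 <;> simp [h]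

/-- Left shift on sequences. -/
def shL (k : Type) [Field k] : Module.End k (ℕ → k) where
  toFun f n := f (n + 1)
  map_add' f g := rfl
  map_smul' c f := rfl

lemma R_e (k : Type) [Field k] : 1 - Xg k * Yg k ≠ 0 := by
  intro h
  let φ : R k →ₐ[k] Module.End k (ℕ → k) := RingQuot.liftAlgHom k
    ⟨FreeAlgebra.lift k ![shR k, shL k], by
      rintro _ _ ⟨⟩
      ext f n
      simp [shR, shL]⟩
  have hX : φ (Xg k) = shR k := by simp [φ, Xg]
  have hY : φ (Yg k) = shL k := by simp [φ, Yg]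
  have h2 := congrArg φ h
  rw [map_sub, map_mul, hX, hY, map_one, map_zero] at h2
  have h3 := congrFun (LinearMap.congr_fun h2 (fun _ => 1)) 0
  simp [shR] at h3

lemma e_mem (k : Type) [Field k] : 1 - Xg k * Yg k ∈ Fideal k :=
  TwoSidedIdeal.subset_span (Set.mem_singleton _)

/-- `F` is an essential left ideal and an essential right ideal of `R`:
every nonzero left ideal meets `F` nontrivially, and every nonzero right ideal
(submodule of `R` over `Rᵐᵒᵖ`) meets `F` nontrivially. -/
theorem F_is_essential (k : Type) [Field k] :
    (∀ I : Ideal (R k), I ≠ ⊥ → ∃ a : R k, a ∈ I ∧ a ∈ Fideal k ∧ a ≠ 0) ∧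
    (∀ J : Submodule (R k)ᵐᵒᵖ (R k), J ≠ ⊥ → ∃ a : R k, a ∈ J ∧ a ∈ Fideal k ∧ a ≠ 0) := by
  have hyx := R_yx k
  have he := R_e k
  constructor
  · intro I hI
    obtain ⟨a, haI, ha0⟩ := Submodule.exists_mem_ne_zero_of_ne_bot hI
    obtain ⟨n, hn⟩ := aux_main (k := k) hyx he (a := a) (by rw [R_adjoin]; trivial) ha0
    exact ⟨_, I.mul_mem_left _ (I.mul_mem_left _ haI),
      TwoSidedIdeal.mul_mem_right _ _ _ (e_mem k), hn⟩
  · intro J hJ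
    obtain ⟨a, haJ, ha0⟩ := Submodule.exists_mem_ne_zero_of_ne_bot hJ
    have hop : ∀ b : R k, MulOpposite.op b ∈ Algebra.adjoin k
        ({MulOpposite.op (Yg k), MulOpposite.op (Xg k)} : Set (R k)ᵐᵒᵖ) := by
      intro b
      have hb : b ∈ Algebra.adjoin k ({Xg k, Yg k} : Set (R k)) := by rw [R_adjoin]; trivial
      induction hb using Algebra.adjoin_induction with
      | mem z hz =>
        apply Algebra.subset_adjoin
        rcases hz with rfl | hz
        · simp
        · rw [Set.mem_singleton_iff] at hz
          simp [hz]
      | algebraMap r => exact Subalgebra.algebraMap_mem _ r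
      | add a b _ _ ha hb => exact add_mem ha hb
      | mul a b _ _ ha hb => exact mul_mem hb ha
    obtain ⟨n, hn⟩ := aux_main (k := k) (x := MulOpposite.op (Yg k)) (y := MulOpposite.op (Xg k))
      (a := MulOpposite.op a) (congrArg MulOpposite.op hyx)
      (fun h => he (MulOpposite.op_injective h)) (hop a)
      (fun h => ha0 (MulOpposite.op_injective h))
    refine ⟨a * Xg k ^ n * (1 - Xg k * Yg k), ?_, TwoSidedIdeal.mul_mem_left _ _ _ (e_mem k), ?_⟩
    · exact J.smul_mem (MulOpposite.op (1 - Xg k * Yg k))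
        (J.smul_mem (MulOpposite.op (Xg k ^ n)) haJ)
    · exact fun h => hn (congrArg MulOpposite.op h)
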